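/- Let (ℙ^{s,η})_{(s,η)∈ℝ₊×Ω} be a path-dependent canonical class satisfying Hypothesis (H). Then for every (s,η) ∈ ℝ₊×Ω, the σ-fields F^o_s and F_s are ℙ^{s,η}-trivial: every event in F_s has ℙ^{s,η}-probability 0 or 1. -/

import Mathlib

open MeasureTheory Filter Topology Set
open scoped NNReal ENNReal

noncomputable section

/-- A function indexed by `ℝ≥0` is *cadlag* if it is right-continuous and has
left limits at every positive time. -/
def IsCadlag {X : Type*} [TopologicalSpace X] (f : ℝ≥0 → X) : Prop :=
  (∀ t : ℝ≥0, Tendsto f (𝓝[Set.Ici t] t) (𝓝 (f t))) ∧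
    ∀ t : ℝ≥0, 0 < t → ∃ l : X, Tendsto f (𝓝[Set.Iio t] t) (𝓝 l)

variable (E : Type*) [TopologicalSpace E] [MeasurableSpace E]

/-- The canonical path space `Ω = D(ℝ₊, E)` of cadlag paths with values in `E`. -/
def PathOmega := {f : ℝ≥0 → E // IsCadlag f}

/-- The canonical σ-field `𝓕 = σ(X_r ; r ≥ 0)` on the path space. -/
instance instPathOmegaMS : MeasurableSpace (PathOmega E) :=
  ⨆ r : ℝ≥0, MeasurableSpace.comap (fun ω : PathOmega E => ω.1 r) inferInstance

/-- The initial filtration `𝓕^o_t = σ(X_r ; r ≤ t)`. -/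
def Fot (t : ℝ≥0) : MeasurableSpace (PathOmega E) :=
  ⨆ r ∈ Set.Iic t, MeasurableSpace.comap (fun ω : PathOmega E => ω.1 r) inferInstance

/-- The canonical (right-continuous) filtration `𝓕_t = ⋂_{s > t} 𝓕^o_s`. -/
def Ft (t : ℝ≥0) : MeasurableSpace (PathOmega E) :=
  ⨅ u ∈ Set.Ioi t, Fot E u

variable {E}

/-- A *path-dependent canonical class*. -/
structure IsPathCanonicalClass (P : ℝ≥0 → PathOmega E → Measure (PathOmega E)) : Prop where
  isProb : ∀ s η, IsProbabilityMeasure (P s η)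
  starts : ∀ (s : ℝ≥0) (η : PathOmega E), P s η {ω | ∀ r ≤ s, ω.1 r = η.1 r} = 1
  fos_meas : ∀ (s : ℝ≥0) (F : Set (PathOmega E)), MeasurableSet F →
    Measurable[Fot E s] fun η => P s η F
  cond : ∀ (s : ℝ≥0) (η : PathOmega E) (t : ℝ≥0), s ≤ t →
    ∀ F : Set (PathOmega E), MeasurableSet F →
      ∀ G : Set (PathOmega E), MeasurableSet[Fot E t] G →
        ∫⁻ ω in G, P t ω F ∂(P s η) = P s η (F ∩ G)

variable (E)

/-- The `ℙ`-closure of a sub-σ-field `G`: the σ-field generated by `G` and the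
`ℙ`-null sets of the ambient σ-field. -/
def pClosure {Ω : Type*} {m0 : MeasurableSpace Ω} (G : MeasurableSpace Ω)
    (μ : @Measure Ω m0) : MeasurableSpace Ω :=
  G ⊔ MeasurableSpace.generateFrom {s | MeasurableSet[m0] s ∧ μ s = 0}


/-- Hypothesis (H): the conditioning property of the canonical class holds with
respect to the canonical filtration `𝓕_t` (and not only `𝓕^o_t`). -/
def HypH (P : ℝ≥0 → PathOmega E → Measure (PathOmega E)) : Prop :=
  ∀ (s : ℝ≥0) (η : PathOmega E) (t : ℝ≥0), s ≤ t →
    ∀ F : Set (PathOmega E), MeasurableSet F →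
      ∀ G : Set (PathOmega E), MeasurableSet[Ft E t] G →
        ∫⁻ ω in G, P t ω F ∂(P s η) = P s η (F ∩ G)

variable {E}

theorem Fot_le (t : ℝ≥0) : Fot E t ≤ instPathOmegaMS E :=
  iSup₂_le fun r _ =>
    le_iSup (fun r : ℝ≥0 => MeasurableSpace.comap (fun ω : PathOmega E => ω.1 r) inferInstance) r

theorem Ft_le (t : ℝ≥0) : Ft E t ≤ instPathOmegaMS E :=
  (iInf₂_le (t + 1) (lt_add_one t)).trans (Fot_le (t + 1))

/-- Events of `Fot E s` depend only on the path up to time `s`. -/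
theorem mem_iff_of_measurableSet_Fot {s : ℝ≥0} {G : Set (PathOmega E)}
    (hG : MeasurableSet[Fot E s] G) {ω η : PathOmega E} (h : ∀ r ≤ s, ω.1 r = η.1 r) :
    ω ∈ G ↔ η ∈ G := by
  have hle : Fot E s ≤
      MeasurableSpace.comap (fun (ω : PathOmega E) (r : Set.Iic s) => ω.1 r) ⊤ := by
    refine iSup₂_le fun r hr => ?_
    rintro _ ⟨B, -, rfl⟩
    exact ⟨{f | f ⟨r, hr⟩ ∈ B}, trivial, rfl⟩
  obtain ⟨B, -, rfl⟩ := hle G hG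
  have heq : (fun r : Set.Iic s => ω.1 r) = fun r : Set.Iic s => η.1 r :=
    funext fun r => h r r.2
  simp only [Set.mem_preimage, heq]

namespace IsPathCanonicalClass

variable {P : ℝ≥0 → PathOmega E → Measure (PathOmega E)}

theorem measure_eq_one_of_mem (hP : IsPathCanonicalClass P) {s : ℝ≥0} {η : PathOmega E}
    {G : Set (PathOmega E)} (hG : MeasurableSet[Fot E s] G) (hη : η ∈ G) : P s η G = 1 := by
  have := hP.isProb s η
  refine le_antisymm prob_le_one ?_
  rw [← hP.starts s η]
  exact measure_mono fun ω hω => (mem_iff_of_measurableSet_Fot hG hω).2 hη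

theorem measure_Fot_eq_zero_or_one (hP : IsPathCanonicalClass P) (s : ℝ≥0) (η : PathOmega E)
    {G : Set (PathOmega E)} (hG : MeasurableSet[Fot E s] G) :
    P s η G = 0 ∨ P s η G = 1 := by
  have := hP.isProb s η
  by_cases hη : η ∈ G
  · exact Or.inr (hP.measure_eq_one_of_mem hG hη)
  · exact Or.inl <| (prob_compl_eq_one_iff (Fot_le s G hG)).1 <|
      hP.measure_eq_one_of_mem (MeasurableSet.compl hG) hη

theorem ae_measure_eq (hP : IsPathCanonicalClass P) (s : ℝ≥0) (η : PathOmega E)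
    {F : Set (PathOmega E)} (hF : MeasurableSet F) :
    ∀ᵐ ω ∂(P s η), P s ω F = P s η F := by
  have := hP.isProb s η
  have hm : MeasurableSet[Fot E s] {ω | P s ω F = P s η F} :=
    hP.fos_meas s F hF (measurableSet_singleton (P s η F))
  exact (mem_ae_iff_prob_eq_one (Fot_le s _ hm)).2 (hP.measure_eq_one_of_mem hm rfl)

end IsPathCanonicalClass

variable (E)

/-- Corollary 2.20: under Hypothesis (H), the σ-fields `𝓕^o_s`
and `𝓕_s` are `ℙ^{s,η}`-trivial: every event has probability `0` or `1`. -/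
theorem Fs_trivial [PolishSpace E] [BorelSpace E]
    (P : ℝ≥0 → PathOmega E → Measure (PathOmega E))
    (hP : IsPathCanonicalClass P) (hH : HypH E P)
    (s : ℝ≥0) (η : PathOmega E) :
    (∀ G : Set (PathOmega E), MeasurableSet[Fot E s] G →
      P s η G = 0 ∨ P s η G = 1) ∧
    (∀ G : Set (PathOmega E), MeasurableSet[Ft E s] G →
      P s η G = 0 ∨ P s η G = 1) := by
  refine ⟨fun G hG => hP.measure_Fot_eq_zero_or_one s η hG, fun G hG => ?_⟩
  have := hP.isProb s η
  have hF : MeasurableSet G := Ft_le s G hG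
  have h := hH s η s le_rfl G hF G hG
  rw [lintegral_congr_ae (ae_restrict_of_ae (hP.ae_measure_eq s η hF)), setLIntegral_const,
    Set.inter_self] at h
  refine or_iff_not_imp_left.2 fun h0 => ?_
  exact (ENNReal.mul_eq_left h0 (measure_ne_top _ _)).1 h
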